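/- Gaps between consecutive lucky numbers: there exist a constant C > 0 and an integer N₀ such that for all n ≥ N₀, l_{n+1} − l_n ≤ C·√(l_n·log l_n). -/

import Mathlib

open scoped BigOperators

namespace LuckyPaper

/-- Rank of `k` in `A`: the number of elements of `A` that are `≤ k`
(the 1-indexed position of `k` in `A` when `k ∈ A`). -/
noncomputable def rank (A : Set ℕ) (k : ℕ) : ℕ := Set.ncard {m | m ∈ A ∧ m ≤ k}

/-- One sieve step: delete every `d`-th element of `A` (listed in increasing order). -/
noncomputable def step (A : Set ℕ) (d : ℕ) : Set ℕ := {k | k ∈ A ∧ ¬ d ∣ rank A k}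

/-- The lucky sieve: `sieve i = (A_i, l_i)`, where `A_0 = {1,2,3,…}`, `l_0 = 1` (dummy),
`l_{i+1}` is the smallest element of `A_i` larger than `l_i`, and `A_{i+1}` is obtained
from `A_i` by deleting every `l_{i+1}`-th element.  In particular `l_1 = 2`. -/
noncomputable def sieve : ℕ → Set ℕ × ℕ
  | 0 => ({n | 1 ≤ n}, 1)
  | i + 1 =>
      let p := sieve i
      let d := sInf {m | m ∈ p.1 ∧ p.2 < m}
      (step p.1 d, d)

/-- `A i` : the set of survivors after `i` steps of the lucky sieve. -/
noncomputable def A (i : ℕ) : Set ℕ := (sieve i).1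

/-- `l i` : the `i`-th sieve parameter (`l 1 = 2`, `l 2 = 3`, `l 3 = 7`, `l 4 = 9`, …);
with this convention `l n` is the `n`-th lucky number for `n ≥ 2`. -/
noncomputable def l (i : ℕ) : ℕ := (sieve i).2

/-- The set of lucky numbers `A_∞ = ⋂ i, A i = {1, 3, 7, 9, 13, 15, 21, 25, …}`. -/
noncomputable def LuckySet : Set ℕ := ⋂ i, A i

/-- `L x` : the number of lucky numbers that are `≤ x`. -/
noncomputable def L (x : ℝ) : ℕ := Set.ncard {m | m ∈ LuckySet ∧ (m : ℝ) ≤ x}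

/-- `R i x = #{k ∈ A_{i-1} : k ≤ x}`. -/
noncomputable def R (i : ℕ) (x : ℝ) : ℕ := Set.ncard {m | m ∈ A (i - 1) ∧ (m : ℝ) ≤ x}

/-- `𝕃 = {l 1, l 2, l 3, …} = {2, 3, 7, 9, 13, …}`. -/
noncomputable def Ell : Set ℕ := {a | ∃ i, 1 ≤ i ∧ l i = a}

/-- `starIdx i m` : the `m`-th number deleted at step `i` of the sieve, i.e. the
`(l i * m)`-th smallest element of `A (i-1)` (`Nat.nth` is 0-indexed). -/
noncomputable def starIdx (i m : ℕ) : ℕ := Nat.nth (· ∈ A (i - 1)) (l i * m - 1)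

/-- The binary operation `*` : for `a ∈ 𝕃`, `star a m = a * m` is the `m`-th number
deleted at the (unique) step `i ≥ 1` with `l i = a`. -/
noncomputable def star (a m : ℕ) : ℕ := starIdx (sInf {i | 1 ≤ i ∧ l i = a}) m

/-- `evalStar [a₁, …, a_k] = a₁ * (a₂ * (⋯ * a_k)⋯)`. -/
noncomputable def evalStar : List ℕ → ℕ
  | [] => 1
  | [a] => a
  | a :: b :: rest => star a (evalStar (b :: rest))

/-- `t = (a₁, …, a_k)` is a lucky factorization of `n` : `k ≥ 1`, `a_j ∈ 𝕃` for `j < k`,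
`a_k` is a lucky number (possibly 1), and `n = a₁*(a₂*(⋯*a_k)⋯)`. -/
def IsLuckyFactorization (n : ℕ) (t : List ℕ) : Prop :=
  t ≠ [] ∧ (∀ a ∈ t.dropLast, a ∈ Ell) ∧ t.getLast! ∈ LuckySet ∧ evalStar t = n

/-- The canonical tuple of `n` given by the fundamental theorem of arithmetic
for lucky numbers. -/
noncomputable def canonicalTuple (n : ℕ) : List ℕ :=
  haveI := Classical.propDecidable (∃ t, IsLuckyFactorization n t)
  if h : ∃ t, IsLuckyFactorization n t then h.choose else []

/-- `Ω°(n)` : the length of the canonical tuple of `n`. -/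
noncomputable def bigOmega (n : ℕ) : ℕ := (canonicalTuple n).length

/-- `ω°(n)` : the number of distinct entries of the canonical tuple of `n`. -/
noncomputable def smallOmega (n : ℕ) : ℕ := (canonicalTuple n).dedup.length

/-- `d°(n)` : the number of distinct nonempty contiguous subtuples (infixes) of the
canonical tuple of `n`. -/
noncomputable def dCirc (n : ℕ) : ℕ :=
  Set.ncard {s : List ℕ | s ≠ [] ∧ s <:+: canonicalTuple n}

/-- `B` : positive integers whose canonical tuple has last entry `≠ 1`. -/
noncomputable def Bset : Set ℕ := {n | 1 ≤ n ∧ (canonicalTuple n).getLast! ≠ 1}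

/-- `C` : positive integers whose canonical tuple ends with the pair `(2, 1)`. -/
noncomputable def Cset : Set ℕ := {n | 1 ≤ n ∧ ∃ t, canonicalTuple n = t ++ [2, 1]}

/-- `S = B ∪ C`. -/
noncomputable def Sset : Set ℕ := Bset ∪ Cset

/-- The `𝕃`-tuple of `a ∈ S` : the canonical tuple of `a` if it does not end in `1`,
else the canonical tuple with the final `1` removed (so it ends in `2`). -/
noncomputable def ellTuple (a : ℕ) : List ℕ :=
  if (canonicalTuple a).getLast! = 1 then (canonicalTuple a).dropLast else canonicalTuple a

/-- The extended operation `∘` : if the `𝕃`-tuple of `a` is `(t₁, …, t_k)`, then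
`a ∘ b = t₁*(t₂*(⋯*(t_k*b)⋯))`. -/
noncomputable def circ (a b : ℕ) : ℕ := (ellTuple a).foldr star b

/-! ### Ranks along the sieve -/

lemma rank_finite (S : Set ℕ) (k : ℕ) : {m | m ∈ S ∧ m ≤ k}.Finite :=
  (Set.finite_Iic k).subset fun _ hm => hm.2

lemma rank_succ_of_mem {S : Set ℕ} {k : ℕ} (h : k + 1 ∈ S) : rank S (k + 1) = rank S k + 1 := by
  have : {m | m ∈ S ∧ m ≤ k + 1} = insert (k + 1) {m | m ∈ S ∧ m ≤ k} := by
    ext m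
    simp only [Set.mem_ofPred_eq, Set.mem_insert_iff]
    grind
  rw [rank, this, Set.ncard_insert_of_notMem (by simp) (rank_finite S k), rank]

lemma rank_succ_of_notMem {S : Set ℕ} {k : ℕ} (h : k + 1 ∉ S) : rank S (k + 1) = rank S k := by
  have : {m | m ∈ S ∧ m ≤ k + 1} = {m | m ∈ S ∧ m ≤ k} := by
    ext m
    simp only [Set.mem_ofPred_eq]
    grind
  rw [rank, this, rank]

lemma rank_zero {S : Set ℕ} (h : 0 ∉ S) : rank S 0 = 0 := by
  have : {m | m ∈ S ∧ m ≤ 0} = ∅ := by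
    ext m
    simp only [Set.mem_ofPred_eq, Set.mem_empty_iff_false]
    grind
  rw [rank, this, Set.ncard_empty]

lemma rank_mono_left {S T : Set ℕ} (h : S ⊆ T) (k : ℕ) : rank S k ≤ rank T k :=
  Set.ncard_le_ncard (fun _ hm => ⟨h hm.1, hm.2⟩) (rank_finite T k)

lemma rank_mono_right (S : Set ℕ) : Monotone (rank S) := fun _ k h =>
  Set.ncard_le_ncard (fun _ hm => ⟨hm.1, hm.2.trans h⟩) (rank_finite S k)

lemma rank_eq_of_gap {S : Set ℕ} {s t : ℕ} (hst : s ≤ t)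
    (h : ∀ m ∈ S, s < m → t < m) : rank S t = rank S s := by
  have : {m | m ∈ S ∧ m ≤ t} = {m | m ∈ S ∧ m ≤ s} := by
    ext m
    simp only [Set.mem_ofPred_eq]
    grind
  rw [rank, this, rank]

lemma rank_eq_succ_of_next {S : Set ℕ} {s t : ℕ} (hst : s < t) (ht : t ∈ S)
    (h : ∀ m ∈ S, s < m → t ≤ m) : rank S t = rank S s + 1 := by
  obtain ⟨t, rfl⟩ : ∃ t', t = t' + 1 := ⟨t - 1, by omega⟩
  rw [rank_succ_of_mem ht, rank_eq_of_gap (Nat.lt_succ_iff.1 hst) h]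

lemma rank_step {S : Set ℕ} (h0 : 0 ∉ S) (d k : ℕ) :
    rank (step S d) k = rank S k - rank S k / d := by
  induction k with
  | zero => rw [rank_zero h0, rank_zero fun h => h0 h.1]; simp
  | succ k ih =>
    by_cases hS : k + 1 ∈ S
    · have hr := rank_succ_of_mem hS
      have hle : rank S k / d ≤ rank S k := Nat.div_le_self _ _
      by_cases hd : d ∣ rank S (k + 1)
      · rw [rank_succ_of_notMem fun h : k + 1 ∈ step S d => h.2 hd, ih, hr, Nat.succ_div,
          if_pos (hr ▸ hd)]
        omega
      · rw [rank_succ_of_mem (show k + 1 ∈ step S d from ⟨hS, hd⟩), ih, hr, Nat.succ_div,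
          if_neg (hr ▸ hd)]
        omega
    · rw [rank_succ_of_notMem fun h : k + 1 ∈ step S d => hS h.1, ih, rank_succ_of_notMem hS]

/-! ### Basic structure of the sieve -/

lemma A_zero : A 0 = {n | 1 ≤ n} := rfl

lemma l_zero : l 0 = 1 := rfl

lemma A_succ (i : ℕ) : A (i + 1) = step (A i) (l (i + 1)) := rfl

lemma l_succ (i : ℕ) : l (i + 1) = sInf {m | m ∈ A i ∧ l i < m} := rfl

lemma A_succ_subset (i : ℕ) : A (i + 1) ⊆ A i := fun _ h => h.1

lemma A_antitone : Antitone A := antitone_nat_of_succ_le A_succ_subset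

lemma zero_notMem_A (i : ℕ) : 0 ∉ A i := fun h => by
  have : 0 ∈ A 0 := A_antitone (Nat.zero_le i) h
  simp [A_zero] at this

lemma rank_A_succ (i k : ℕ) :
    rank (A (i + 1)) k = rank (A i) k - rank (A i) k / l (i + 1) := by
  rw [A_succ, rank_step (zero_notMem_A i)]

lemma rank_A_zero (k : ℕ) : rank (A 0) k = k := by
  induction k with
  | zero => exact rank_zero (zero_notMem_A 0)
  | succ k ih => rw [rank_succ_of_mem (by simp [A_zero]), ih]

lemma exists_next_of_rank_unbounded {S : Set ℕ} (h : ∀ N, ∃ t, N ≤ rank S t) (s : ℕ) :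
    ∃ m, m ∈ S ∧ s < m := by
  by_contra! hc
  obtain ⟨t, ht⟩ := h (rank S s + 1)
  have hst : s ≤ t := by
    by_contra! hts
    have := rank_mono_right S hts.le
    omega
  have := rank_eq_of_gap hst fun m hm hsm => absurd (hc m hm) (by omega)
  omega

lemma rank_A_unbounded_and_one_le_l (i : ℕ) :
    (∀ N, ∃ t, N ≤ rank (A i) t) ∧ 1 ≤ l i := by
  induction i with
  | zero => exact ⟨fun N => ⟨N, (rank_A_zero N).ge⟩, le_rfl⟩
  | succ i ih =>
    have hl : l i < l (i + 1) :=
      (Nat.sInf_mem (s := {m | m ∈ A i ∧ l i < m}) (exists_next_of_rank_unbounded ih.1 (l i))).2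
    refine ⟨fun N => ?_, by omega⟩
    obtain ⟨t, ht⟩ := ih.1 (2 * N)
    refine ⟨t, ?_⟩
    rw [rank_A_succ]
    have : rank (A i) t / l (i + 1) ≤ rank (A i) t / 2 := Nat.div_le_div_left (by omega) (by omega)
    omega

lemma l_succ_mem (i : ℕ) : l (i + 1) ∈ A i ∧ l i < l (i + 1) :=
  Nat.sInf_mem (s := {m | m ∈ A i ∧ l i < m})
    (exists_next_of_rank_unbounded (rank_A_unbounded_and_one_le_l i).1 (l i))

lemma l_succ_le {i m : ℕ} (hm : m ∈ A i) (h : l i < m) : l (i + 1) ≤ m :=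
  Nat.sInf_le ⟨hm, h⟩

lemma succ_le_l (i : ℕ) : i + 1 ≤ l i := by
  induction i with
  | zero => exact le_rfl
  | succ i ih => have := (l_succ_mem i).2; omega

lemma l_one : l 1 = 2 :=
  le_antisymm (l_succ_le (i := 0) (by simp [A_zero]) (by simp [l_zero])) (succ_le_l 1)

lemma odd_of_mem_A {i k : ℕ} (h : k ∈ A (i + 1)) : ¬ 2 ∣ k := by
  have : k ∈ A 1 := A_antitone (by omega) h
  rw [A_succ, l_one] at this
  simpa [rank_A_zero] using this.2

lemma l_add_two_le (i : ℕ) : l (i + 2) + 2 ≤ l (i + 3) := by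
  have h1 := odd_of_mem_A (l_succ_mem (i + 1)).1
  have h2 := odd_of_mem_A (l_succ_mem (i + 2)).1
  have h3 := (l_succ_mem (i + 2)).2
  simp only [add_assoc, Nat.reduceAdd] at *
  omega

lemma rank_A_l_succ_eq (i : ℕ) : rank (A i) (l (i + 1)) = rank (A i) (l i) + 1 :=
  rank_eq_succ_of_next (l_succ_mem i).2 (l_succ_mem i).1 fun _ hm h => l_succ_le hm h

lemma rank_A_lt {i k : ℕ} (hk : 2 ≤ k) : rank (A (i + 1)) k < k := by
  refine (rank_mono_left (A_antitone (show 1 ≤ i + 1 by omega)) k).trans_lt ?_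
  rw [rank_A_succ, rank_A_zero, l_one]
  omega

lemma rank_A_l_succ (i : ℕ) : rank (A (i + 1)) (l (i + 2)) = i + 2 := by
  rw [rank_A_l_succ_eq (i + 1)]
  induction i with
  | zero => rw [rank_A_succ, rank_A_zero, l_one]
  | succ i ih =>
    have hlt : rank (A (i + 1)) (l (i + 2)) < l (i + 2) :=
      rank_A_lt (by have := succ_le_l (i + 2); omega)
    rw [rank_A_succ (i + 1), Nat.div_eq_of_lt hlt, rank_A_l_succ_eq (i + 1)]
    omega

/-! ### The survivors between two consecutive lucky numbers -/

/-- At every stage `j`, the number of survivors in `(l n, l (n+1)]` exceeds the number of multiples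
of `l (j+1)` up to the rank of `l (n+1)` by at most one. -/
lemma rank_gap_le {n j : ℕ} (hj : 1 ≤ j) (hjn : j ≤ n) :
    rank (A j) (l (n + 1)) ≤ rank (A j) (l n) + 1 + rank (A j) (l (n + 1)) / l (j + 1) := by
  induction hjn using Nat.decreasingInduction with
  | self => rw [rank_A_l_succ_eq]; exact Nat.le_add_right _ _
  | of_succ j hjn ih =>
    have ih := ih (by omega)
    have hp := rank_A_succ j (l n)
    have hq := rank_A_succ j (l (n + 1))
    obtain ⟨i, rfl⟩ : ∃ i, j = i + 1 := ⟨j - 1, by omega⟩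
    have hl := l_add_two_le i
    have hl1 : 2 ≤ l (i + 2) := by have := succ_le_l (i + 2); omega
    simp only [add_assoc, Nat.reduceAdd] at *
    set p := rank (A (i + 1)) (l n)
    set q := rank (A (i + 1)) (l (n + 1))
    set p' := rank (A (i + 2)) (l n)
    set q' := rank (A (i + 2)) (l (n + 1))
    have hpl := Nat.div_le_self p (l (i + 2))
    have hql := Nat.div_le_self q (l (i + 2))
    suffices h : q' ≤ p' + 1 + p / l (i + 2) by omega
    by_contra! hc
    set F := q' / l (i + 3)
    have hF : p / l (i + 2) + 1 ≤ F := by omega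
    have hFq : F * l (i + 3) ≤ q' := Nat.div_mul_le_self _ _
    have hpm : p < l (i + 2) * (p / l (i + 2) + 1) := Nat.lt_mul_div_succ _ (by omega)
    set g := p / l (i + 2)
    have hp' : p' ≤ (g + 1) * (l (i + 2) - 1) := by
      obtain ⟨d, hd⟩ : ∃ d, l (i + 2) = d + 1 := ⟨l (i + 2) - 1, by omega⟩
      rw [hd] at hpm ⊢
      simp only [Nat.add_sub_cancel]
      have : (d + 1) * (g + 1) = (g + 1) * d + g + 1 := by ring
      omega
    have h1 : (g + 1) * (l (i + 2) - 1) ≤ F * (l (i + 2) - 1) := Nat.mul_le_mul_right _ hF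
    have h2 : F * (l (i + 2) - 1 + 3) ≤ F * l (i + 3) := Nat.mul_le_mul_left _ (by omega)
    rw [mul_add] at h2
    clear_value F g
    omega

/-! ### The sieve density -/

/-- The reciprocal of the density of `A j`, i.e. `∏_{i ≤ j} (1 - 1 / l i)⁻¹`. -/
noncomputable def invDensity (j : ℕ) : ℝ :=
  ∏ i ∈ Finset.range j, ((l (i + 1) : ℝ) / (l (i + 1) - 1))

lemma invDensity_zero : invDensity 0 = 1 := by simp [invDensity]

lemma invDensity_succ (j : ℕ) :
    invDensity (j + 1) = invDensity j * ((l (j + 1) : ℝ) / (l (j + 1) - 1)) := by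
  rw [invDensity, Finset.prod_range_succ, invDensity]

lemma add_two_le_l_succ (j : ℕ) : (j : ℝ) + 2 ≤ l (j + 1) := by
  exact_mod_cast succ_le_l (j + 1)

lemma invDensity_pos (j : ℕ) : 0 < invDensity j := by
  refine Finset.prod_pos fun i _ => ?_
  have := add_two_le_l_succ i
  have : (0 : ℝ) ≤ i := i.cast_nonneg
  exact div_pos (by linarith) (by linarith)

lemma invDensity_succ_mul (j : ℕ) :
    invDensity (j + 1) * (l (j + 1) - 1) = invDensity j * l (j + 1) := by
  have := add_two_le_l_succ j
  have : (0 : ℝ) ≤ j := j.cast_nonneg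
  have : (l (j + 1) : ℝ) - 1 ≠ 0 := by linarith
  rw [invDensity_succ]
  field_simp

lemma invDensity_le_succ (j : ℕ) : invDensity j ≤ invDensity (j + 1) := by
  have h := invDensity_succ_mul j
  have h1 := add_two_le_l_succ j
  have h0 : (0 : ℝ) ≤ j := j.cast_nonneg
  have := invDensity_pos (j + 1)
  by_contra! hc
  nlinarith

lemma rank_A_succ_cast (j k : ℕ) :
    (rank (A (j + 1)) k : ℝ) =
      rank (A j) k - ((rank (A j) k / l (j + 1) : ℕ) : ℝ) := by
  rw [rank_A_succ, Nat.cast_sub (Nat.div_le_self _ _)]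

lemma mul_cast_div_le (p d : ℕ) : (d : ℝ) * ((p / d : ℕ) : ℝ) ≤ p := by
  exact_mod_cast Nat.mul_div_le p d

lemma lt_mul_cast_div {d : ℕ} (p : ℕ) (hd : 0 < d) :
    (p : ℝ) < d * ((p / d : ℕ) : ℝ) + d := by
  have := Nat.lt_mul_div_succ p hd
  rw [mul_add, mul_one] at this
  exact_mod_cast this

/-- Upper bound for ranks at stage `j`. -/
lemma invDensity_mul_rank_le (j k : ℕ) :
    invDensity j * rank (A j) k ≤ k + j * invDensity j := by
  induction j with
  | zero => simp [invDensity_zero, rank_A_zero]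
  | succ j ih =>
    have hu := invDensity_succ_mul j
    have hu0 := invDensity_pos (j + 1)
    have hu1 := invDensity_le_succ j
    have hl := add_two_le_l_succ j
    have h0 : (0 : ℝ) ≤ j := j.cast_nonneg
    have hd := lt_mul_cast_div (rank (A j) k) (Nat.zero_lt_of_lt (succ_le_l (j + 1)))
    have hlt : (l (j + 1) : ℝ) * rank (A (j + 1)) k
        ≤ (l (j + 1) - 1) * rank (A j) k + l (j + 1) := by
      rw [rank_A_succ_cast]
      linarith
    have key : (l (j + 1) : ℝ) * (invDensity (j + 1) * rank (A (j + 1)) k)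
        ≤ l (j + 1) * (invDensity j * rank (A j) k + invDensity (j + 1)) := by
      calc (l (j + 1) : ℝ) * (invDensity (j + 1) * rank (A (j + 1)) k)
          = invDensity (j + 1) * (l (j + 1) * rank (A (j + 1)) k) := by ring
        _ ≤ invDensity (j + 1) * ((l (j + 1) - 1) * rank (A j) k + l (j + 1)) := by gcongr
        _ = invDensity (j + 1) * (l (j + 1) - 1) * rank (A j) k
              + invDensity (j + 1) * l (j + 1) := by ring
        _ = _ := by rw [hu]; ring
    have := le_of_mul_le_mul_left key (by linarith)
    push_cast
    nlinarith

/-- The length of an interval in terms of the number of its elements surviving to stage `j`. -/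
lemma sub_le_invDensity_mul (j a b : ℕ) :
    (b : ℝ) - a ≤ invDensity j * (rank (A j) b - rank (A j) a + j) := by
  induction j with
  | zero => simp [invDensity_zero, rank_A_zero]
  | succ j ih =>
    have hu := invDensity_succ_mul j
    have hu0 := invDensity_pos j
    have hu1 := invDensity_pos (j + 1)
    have hl := add_two_le_l_succ j
    have h0 : (0 : ℝ) ≤ j := j.cast_nonneg
    have hb := mul_cast_div_le (rank (A j) b) (l (j + 1))
    have ha := lt_mul_cast_div (rank (A j) a) (Nat.zero_lt_of_lt (succ_le_l (j + 1)))
    have hlt : ((l (j + 1) : ℝ) - 1) * (rank (A j) b - rank (A j) a + j)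
        ≤ l (j + 1) * (rank (A (j + 1)) b - rank (A (j + 1)) a + (j + 1)) := by
      rw [rank_A_succ_cast, rank_A_succ_cast]
      nlinarith
    have key : ((l (j + 1) : ℝ) - 1) * (invDensity j * (rank (A j) b - rank (A j) a + j))
        ≤ (l (j + 1) - 1) *
          (invDensity (j + 1) * (rank (A (j + 1)) b - rank (A (j + 1)) a + (j + 1))) := by
      calc ((l (j + 1) : ℝ) - 1) * (invDensity j * (rank (A j) b - rank (A j) a + j))
          = invDensity j * ((l (j + 1) - 1) * (rank (A j) b - rank (A j) a + j)) := by ring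
        _ ≤ invDensity j *
            (l (j + 1) * (rank (A (j + 1)) b - rank (A (j + 1)) a + (j + 1))) := by gcongr
        _ = invDensity j * l (j + 1) *
            (rank (A (j + 1)) b - rank (A (j + 1)) a + (j + 1)) := by ring
        _ = _ := by rw [← hu]; ring
    have := le_of_mul_le_mul_left key (by linarith)
    push_cast
    linarith

lemma mul_invDensity_le {J I : ℕ} (hJI : J ≤ I) :
    J * invDensity I ≤ I * invDensity J := by
  induction I, hJI using Nat.le_induction with
  | base => exact le_rfl
  | succ I hJI ih =>
    have hu := invDensity_succ_mul I
    have hu1 := invDensity_pos (I + 1)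
    have hu0 := invDensity_pos I
    have huJ := invDensity_pos J
    have hl := add_two_le_l_succ I
    have h0 : (0 : ℝ) ≤ I := I.cast_nonneg
    have hJ0 : (0 : ℝ) ≤ J := J.cast_nonneg
    have hJI' : (J : ℝ) ≤ I := by exact_mod_cast hJI
    have hstep : I * invDensity (I + 1) ≤ (I + 1) * invDensity I := by
      have : (0 : ℝ) < l (I + 1) - 1 := by linarith
      refine le_of_mul_le_mul_right ?_ this
      calc I * invDensity (I + 1) * (l (I + 1) - 1)
          = I * (invDensity I * l (I + 1)) := by rw [mul_assoc, hu]
        _ ≤ (I + 1) * invDensity I * (l (I + 1) - 1) := by nlinarith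
    rcases h0.eq_or_lt with h | h
    · have : (J : ℝ) = 0 := by linarith
      rw [this]
      simp only [zero_mul]
      positivity
    · refine le_of_mul_le_mul_left ?_ h
      push_cast
      calc (I : ℝ) * (J * invDensity (I + 1)) = J * (I * invDensity (I + 1)) := by ring
        _ ≤ J * ((I + 1) * invDensity I) := by gcongr
        _ = (I + 1) * (J * invDensity I) := by ring
        _ ≤ (I + 1) * (I * invDensity J) := by gcongr
        _ = _ := by ring

lemma mul_invDensity_le_l {I : ℕ} (hI : 2 ≤ I) :
    (I + 1) * invDensity I ≤ 6 * l (I + 1) := by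
  obtain ⟨i, rfl⟩ : ∃ i, I = i + 1 := ⟨I - 1, by omega⟩
  set J := (i + 1) / 2
  have hrank : (i : ℝ) + 2 ≤ rank (A J) (l (i + 2)) := by
    have := rank_mono_left (A_antitone (show J ≤ i + 1 by omega)) (l (i + 2))
    rw [rank_A_l_succ] at this
    exact_mod_cast this
  have hup := invDensity_mul_rank_le J (l (i + 2))
  have hcmp := mul_invDensity_le (show J ≤ i + 1 by omega)
  have hJ1 : ((i + 1 : ℕ) : ℝ) ≤ 3 * J := by exact_mod_cast (by omega : i + 1 ≤ 3 * J)
  have hJ2 : 2 * (J : ℝ) ≤ i + 1 := by exact_mod_cast (by omega : 2 * J ≤ i + 1)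
  have huJ := invDensity_pos J
  have hu := invDensity_pos (i + 1)
  have hJpos : (0 : ℝ) < J := by exact_mod_cast (by omega : 0 < J)
  have h3 : invDensity (i + 1) ≤ 3 * invDensity J := by
    refine le_of_mul_le_mul_left ?_ hJpos
    nlinarith
  have h4 : invDensity J * (i + 2 - J) ≤ l (i + 2) := by nlinarith
  push_cast
  rw [show i + 1 + 1 = i + 2 from rfl]
  have h0 : (0 : ℝ) ≤ i := i.cast_nonneg
  nlinarith

lemma invDensity_le_log {I : ℕ} (hI : 1 ≤ I) : invDensity I ≤ 4 + 12 * Real.log I := by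
  have h1 : invDensity 1 = 2 := by
    rw [invDensity_succ, invDensity_zero, l_one]
    norm_num
  rcases hI.eq_or_lt with rfl | hI
  · rw [h1]; norm_num
  · induction I, (show 2 ≤ I from hI) using Nat.le_induction with
    | base =>
      have := mul_invDensity_le (show 1 ≤ 2 by norm_num)
      rw [h1] at this
      have hlog := Real.log_nonneg (show (1 : ℝ) ≤ (2 : ℕ) by norm_num)
      push_cast at *
      linarith
    | succ I hI2 ih =>
      have ih := ih (by omega) (by omega)
      have hu := invDensity_succ_mul I
      have hl := add_two_le_l_succ I
      have hm := mul_invDensity_le_l hI2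
      have hu0 := invDensity_pos I
      have hIpos : (0 : ℝ) < I := by exact_mod_cast (by omega : 0 < I)
      have hlog : 1 / ((I : ℝ) + 1) ≤ Real.log (I + 1) - Real.log I := by
        have := Real.one_sub_inv_le_log_of_pos (show (0 : ℝ) < (I + 1) / I by positivity)
        rw [Real.log_div (by positivity) (by positivity)] at this
        refine le_trans (le_of_eq ?_) this
        field_simp
        ring
      have hinc : invDensity (I + 1) - invDensity I ≤ 12 * (1 / ((I : ℝ) + 1)) := by
        have hl0 : (0 : ℝ) < l (I + 1) - 1 := by linarith
        have : invDensity (I + 1) - invDensity I = invDensity I / (l (I + 1) - 1) := by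
          rw [eq_div_iff hl0.ne']
          linarith
        rw [this, mul_one_div, div_le_div_iff₀ hl0 (by positivity)]
        linarith
      push_cast
      linarith

/-- gaps between consecutive lucky numbers: there exist `C > 0` and `N₀`
such that for all `n ≥ N₀`, `l_{n+1} − l_n ≤ C·√(l_n·log l_n)`. -/
theorem lucky_gap_bound :
    ∃ C : ℝ, 0 < C ∧ ∃ N₀ : ℕ, ∀ n : ℕ, N₀ ≤ n →
      (l (n + 1) : ℝ) - (l n : ℝ) ≤ C * Real.sqrt ((l n : ℝ) * Real.log (l n : ℝ)) := by
  refine ⟨100, by norm_num, 2, fun n hn => ?_⟩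
  have han : n + 1 ≤ l n := succ_le_l n
  have ha3 : (3 : ℝ) ≤ l n := by exact_mod_cast (by omega : 3 ≤ l n)
  set a : ℝ := (l n : ℝ) with ha
  have hlog : 1 ≤ Real.log a := by
    rw [Real.le_log_iff_exp_le (by linarith)]
    linarith [Real.exp_one_lt_three]
  set w := Real.sqrt (a / Real.log a) with hw
  set s := Real.sqrt (a * Real.log a) with hs
  have hs0 : 0 ≤ s := Real.sqrt_nonneg _
  have hws : w * s = a := by
    rw [hw, hs, ← Real.sqrt_mul (by positivity)]
    rw [show a / Real.log a * (a * Real.log a) = a ^ 2 by field_simp]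
    exact Real.sqrt_sq (by linarith)
  have hw1 : 1 ≤ w := by
    rw [hw, Real.one_le_sqrt, le_div_iff₀ (by linarith)]
    linarith [Real.log_le_sub_one_of_pos (show 0 < a by linarith)]
  have hwlog : w * Real.log a = s := by
    rw [hw, hs, ← Real.sqrt_sq (show 0 ≤ Real.log a by linarith),
      ← Real.sqrt_mul (by positivity), Real.sqrt_sq (show 0 ≤ Real.log a by linarith)]
    congr 1
    field_simp
  have hdens : ∀ j : ℕ, 1 ≤ j → j ≤ n → invDensity j ≤ 16 * Real.log a := fun j h1 hjn => by
    have := invDensity_le_log h1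
    have : Real.log j ≤ Real.log a :=
      Real.log_le_log (by exact_mod_cast h1) (by rw [ha]; exact_mod_cast (by omega : j ≤ l n))
    linarith
  set I := ⌊w⌋₊
  have hIw : (I : ℝ) ≤ w := Nat.floor_le (by linarith)
  have hwI : w < I + 1 := Nat.lt_floor_add_one w
  have hI1 : 1 ≤ I := Nat.one_le_floor_iff w |>.2 hw1
  rcases le_or_gt n I with hnI | hnI
  · have hgap := sub_le_invDensity_mul n (l n) (l (n + 1))
    rw [rank_A_l_succ_eq] at hgap
    have hd := hdens n (by omega) le_rfl
    have hnw : (n : ℝ) ≤ w := le_trans (by exact_mod_cast hnI) hIw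
    have hn0 : (0 : ℝ) ≤ n := n.cast_nonneg
    push_cast at hgap
    calc (l (n + 1) : ℝ) - a ≤ invDensity n * (1 + n) := by linarith
      _ ≤ 16 * Real.log a * (w + w) := by gcongr
      _ = 32 * s := by rw [← hwlog]; ring
      _ ≤ 100 * s := by linarith
  · have hgap := sub_le_invDensity_mul I (l n) (l (n + 1))
    have hd := hdens I hI1 hnI.le
    have hu := invDensity_pos I
    have hp := invDensity_mul_rank_le I (l n)
    have hl := add_two_le_l_succ I
    have hI0 : (1 : ℝ) ≤ I := by exact_mod_cast hI1
    have hD : (rank (A I) (l (n + 1)) : ℝ) ≤ rank (A I) (l n) + 1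
        + ((rank (A I) (l (n + 1)) / l (I + 1) : ℕ) : ℝ) := by
      exact_mod_cast rank_gap_le hI1 hnI.le
    have hq := mul_cast_div_le (rank (A I) (l (n + 1))) (l (I + 1))
    set p : ℝ := (rank (A I) (l n) : ℝ)
    set q : ℝ := (rank (A I) (l (n + 1)) : ℝ)
    set t : ℝ := (l (I + 1) : ℝ)
    have hDt : (q - p) * t ≤ 2 * t + 2 * p := by nlinarith
    have hat : a ≤ s * t := by rw [← hws]; nlinarith
    have hus : invDensity I * I ≤ 16 * s := by
      calc invDensity I * I ≤ 16 * Real.log a * w := by gcongr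
        _ = 16 * s := by rw [← hwlog]; ring
    have hus' : invDensity I ≤ 16 * s := by nlinarith
    have ht : 0 < t := by linarith
    have key : ((l (n + 1) : ℝ) - a) * t ≤ 82 * s * t := by
      calc ((l (n + 1) : ℝ) - a) * t ≤ invDensity I * (q - p + I) * t := by gcongr
        _ = invDensity I * ((q - p) * t) + invDensity I * I * t := by ring
        _ ≤ invDensity I * (2 * t + 2 * p) + invDensity I * I * t := by gcongr
        _ = 2 * invDensity I * t + 2 * (invDensity I * p) + invDensity I * I * t := by ring
        _ ≤ 2 * invDensity I * t + 2 * (s * t + t * invDensity I) + invDensity I * I * t := by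
          have : I * invDensity I ≤ t * invDensity I := by gcongr; linarith
          linarith
        _ = (4 * invDensity I + 2 * s + invDensity I * I) * t := by ring
        _ ≤ 82 * s * t := by gcongr; linarith
    have := le_of_mul_le_mul_right key ht
    linarith

end LuckyPaper
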